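/- Let G be a finite group and N a proper characteristic subgroup of G. If N is isomorphic to one of the groups A₅, A₆, PSL(2,7) or PSL(2,8), then ω(G) ≥ 7. -/

import Mathlib

open scoped MatrixGroups

/-- The number of orbits of the natural action of the automorphism group `Aut G`
on the group `G`. -/
noncomputable def omegaAut (G : Type*) [Group G] : ℕ :=
  Nat.card (MulAction.orbitRel.Quotient (MulAut G) G)

/-! ### Counting orbits by element orders inside and outside a characteristic subgroup -/

section Outside

variable {G : Type*} [Group G] [Finite G] {N : Subgroup G}

theorem card_add_card_le_omegaAut (N : Subgroup G) [hN : N.Characteristic] (A B : Finset ℕ)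
    (hA : ∀ a ∈ A, ∃ g ∈ N, orderOf g = a) (hB : ∀ b ∈ B, ∃ g ∉ N, orderOf g = b) :
    A.card + B.card ≤ omegaAut G := by
  classical
  let f : G → ℕ ⊕ ℕ := fun g => if g ∈ N then Sum.inl (orderOf g) else Sum.inr (orderOf g)
  have hf : ∀ g h : G, MulAction.orbitRel (MulAut G) G g h → f g = f h := by
    rintro _ h ⟨σ, rfl⟩
    have hmem : σ h ∈ N ↔ h ∈ N := by
      conv_rhs => rw [← Subgroup.characteristic_iff_comap_eq.1 hN σ]
      rfl
    have hord : orderOf (σ h) = orderOf h := MulEquiv.orderOf_eq σ h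
    simp only [f, MulAut.smul_def, hmem, hord]
  let F : MulAction.orbitRel.Quotient (MulAut G) G → ℕ ⊕ ℕ := Quotient.lift f hf
  let := Fintype.ofFinite (MulAction.orbitRel.Quotient (MulAut G) G)
  have hsub : A.disjSum B ⊆ Finset.univ.image F := by
    intro x hx
    rw [Finset.mem_image]
    rcases Finset.mem_disjSum.1 hx with ⟨a, ha, rfl⟩ | ⟨b, hb, rfl⟩
    · obtain ⟨g, hg, hga⟩ := hA a ha
      exact ⟨Quotient.mk _ g, Finset.mem_univ _, by simp [F, f, hg, hga]⟩
    · obtain ⟨g, hg, hgb⟩ := hB b hb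
      exact ⟨Quotient.mk _ g, Finset.mem_univ _, by simp [F, f, hg, hgb]⟩
  calc A.card + B.card = (A.disjSum B).card := (Finset.card_disjSum A B).symm
    _ ≤ (Finset.univ.image F).card := Finset.card_le_card hsub
    _ ≤ (Finset.univ : Finset (MulAction.orbitRel.Quotient (MulAut G) G)).card :=
      Finset.card_image_le
    _ = omegaAut G := by rw [omegaAut, Nat.card_eq_fintype_card, Finset.card_univ]

theorem seven_le_omegaAut_of_five_orders [N.Characteristic] (A : Finset ℕ) (hA5 : A.card = 5)
    (hA : ∀ a ∈ A, ∃ g ∈ N, orderOf g = a) (hout : ∀ m, ¬ ∀ x ∉ N, orderOf x = m) :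
    7 ≤ omegaAut G := by
  have h0 := hout 0
  push Not at h0
  obtain ⟨x, hx, -⟩ := h0
  have h1 := hout (orderOf x)
  push Not at h1
  obtain ⟨y, hy, hxy⟩ := h1
  have := card_add_card_le_omegaAut N A {orderOf y, orderOf x} hA (by
    intro b hb
    rcases Finset.mem_insert.1 hb with rfl | hb
    · exact ⟨y, hy, rfl⟩
    · exact ⟨x, hx, (Finset.mem_singleton.1 hb).symm⟩)
  rwa [hA5, Finset.card_pair hxy] at this

/-! ### Subgroups all of whose outside elements have the same order -/

omit [Finite G] in
theorem mem_of_pow_mem_of_coprime {x : G} {a b : ℕ} (hab : a.Coprime b) (ha : x ^ a ∈ N)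
    (hb : x ^ b ∈ N) : x ∈ N := by
  have h : (1 : ℤ) = a * a.gcdA b + b * a.gcdB b := by
    rw [← Nat.gcd_eq_gcd_ab, hab.gcd_eq_one, Nat.cast_one]
  rw [← zpow_one x, h, zpow_add, zpow_mul, zpow_mul, zpow_natCast, zpow_natCast]
  exact N.mul_mem (N.zpow_mem ha _) (N.zpow_mem hb _)

omit [Finite G] in
theorem exists_notMem_of_ne_top (hN : N ≠ ⊤) : ∃ x, x ∉ N := by
  by_contra! h
  exact hN ((Subgroup.eq_top_iff' N).2 h)

theorem exists_prime_pow_of_forall_orderOf_eq {m : ℕ} (hN : N ≠ ⊤)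
    (hm : ∀ x ∉ N, orderOf x = m) :
    ∃ p : ℕ, p.Prime ∧ (∃ a, m = p ^ a) ∧ ∀ x ∉ N, x ^ p ∈ N := by
  obtain ⟨x₀, hx₀⟩ := exists_notMem_of_ne_top hN
  have hm0 : m ≠ 0 := by
    rw [← hm x₀ hx₀]
    exact (orderOf_pos x₀).ne'
  have hm1 : m ≠ 1 := by
    rw [← hm x₀ hx₀]
    intro h
    rw [orderOf_eq_one_iff] at h
    exact hx₀ (h ▸ N.one_mem)
  have key : ∀ q : ℕ, q.Prime → q ∣ m → ∀ x ∉ N, x ^ q ∈ N := by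
    intro q hq hqm x hx
    by_contra hxq
    have h1 := hm _ hxq
    have h2 := hm _ hx
    rw [orderOf_pow_of_dvd hq.ne_zero (h2 ▸ hqm), h2] at h1
    exact (Nat.div_lt_self (Nat.pos_of_ne_zero hm0) hq.one_lt).ne h1
  refine ⟨m.minFac, Nat.minFac_prime hm1, ⟨_, Nat.eq_prime_pow_of_unique_prime_dvd hm0 ?_⟩,
    key _ (Nat.minFac_prime hm1) (Nat.minFac_dvd m)⟩
  intro d hd hdm
  by_contra hne
  exact hx₀ (mem_of_pow_mem_of_coprime ((Nat.coprime_primes hd (Nat.minFac_prime hm1)).2 hne)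
    (key d hd hdm x₀ hx₀) (key _ (Nat.minFac_prime hm1) (Nat.minFac_dvd m) x₀ hx₀))

theorem eq_one_of_commute_notMem {m : ℕ} (hm : ∀ x ∉ N, orderOf x = m) {x n : G} (hx : x ∉ N)
    (hn : n ∈ N) (hc : Commute x n) (hcop : m.Coprime (orderOf n)) : n = 1 := by
  have h := hc.orderOf_mul_eq_mul_orderOf_of_coprime (by rwa [hm x hx])
  rw [hm _ (fun h => hx ((N.mul_mem_cancel_right hn).1 h)), hm x hx] at h
  have hpos : 0 < m := hm x hx ▸ orderOf_pos x
  exact orderOf_eq_one_iff.1 (Nat.eq_of_mul_eq_mul_left hpos (by rw [← h, mul_one]))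

theorem exists_notMem_mem_normalizer_sylow [N.Normal] (hN : N ≠ ⊤) {q : ℕ} [Fact q.Prime]
    (P : Sylow q N) :
    ∃ x ∉ N, x ∈ Subgroup.normalizer ((P : Subgroup N).map N.subtype : Set G) := by
  by_contra! h
  have hle : Subgroup.normalizer ((P : Subgroup N).map N.subtype : Set G) ≤ N :=
    fun x hx => by_contra fun hxN => h x hxN hx
  exact hN (by rw [← Sylow.normalizer_sup_eq_top P, sup_eq_right.2 hle])

theorem exists_conj_eq_pow [N.Normal] (hN : N ≠ ⊤) {q : ℕ} [Fact q.Prime]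
    (hq : (Nat.card N).factorization q = 1) {t : G} (ht : t ∈ N) (hto : orderOf t = q) :
    ∃ x ∉ N, ∃ j : ℕ, x * t * x⁻¹ = t ^ j := by
  let P : Sylow q N := Sylow.ofCard (Subgroup.zpowers (⟨t, ht⟩ : N)) (by
    rw [Nat.card_zpowers, Subgroup.orderOf_mk, hto, hq, pow_one])
  obtain ⟨x, hx, hxP⟩ := exists_notMem_mem_normalizer_sylow hN P
  refine ⟨x, hx, ?_⟩
  have hP : (P : Subgroup N).map N.subtype = Subgroup.zpowers t := by
    rw [Sylow.coe_ofCard, MonoidHom.map_zpowers]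
    rfl
  rw [hP] at hxP
  have h := (Subgroup.mem_normalizer_iff.1 hxP t).1 (Subgroup.mem_zpowers t)
  obtain ⟨j, hj⟩ := mem_powers_iff_mem_zpowers.2 h
  exact ⟨j, hj.symm⟩

theorem pow_factorization_modEq_one [N.Normal] (hN : N ≠ ⊤) {m p a q : ℕ} (hp : p.Prime)
    (hq : q.Prime) (hpq : p ≠ q) (hma : m = p ^ a) (hm : ∀ x ∉ N, orderOf x = m) :
    q ^ (Nat.card N).factorization q ≡ 1 [MOD p] := by
  have := Fact.mk hp
  have := Fact.mk hq
  let P : Sylow q N := default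
  obtain ⟨x, hx, hxP⟩ := exists_notMem_mem_normalizer_sylow hN P
  set Q : Subgroup G := (P : Subgroup N).map N.subtype with hQ
  have hcard : Nat.card Q = q ^ (Nat.card N).factorization q := by
    rw [← P.card_eq_multiplicity]
    exact (Nat.card_congr
      ((P : Subgroup N).equivMapOfInjective N.subtype N.subtype_injective).toEquiv).symm
  have hQN : ∀ y ∈ Q, y ∈ N := by
    rintro _ ⟨y, -, rfl⟩
    exact y.2
  let f : Subgroup.zpowers x →* MulAut Q :=
    Q.normalizerMonoidHom.comp (Subgroup.inclusion (Subgroup.zpowers_le.2 hxP))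
  let : MulAction (Subgroup.zpowers x) Q := MulAction.compHom Q f
  have hpg : IsPGroup p (Subgroup.zpowers x) :=
    IsPGroup.of_card (n := a) (by rw [Nat.card_zpowers, hm x hx, hma])
  have hmod := hpg.card_modEq_card_fixedPoints Q
  have hfix : MulAction.fixedPoints (Subgroup.zpowers x) Q = {1} := by
    ext y
    rw [Set.mem_singleton_iff]
    constructor
    · intro hy
      have h := congrArg Subtype.val (hy ⟨x, Subgroup.mem_zpowers x⟩)
      have h' : x * (y : G) * x⁻¹ = y := h
      have hc : Commute x (y : G) := mul_inv_eq_iff_eq_mul.1 h'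
      obtain ⟨k, hk⟩ := (IsPGroup.of_card hcard) y
      have hyq : orderOf (y : G) ∣ q ^ k := by
        apply orderOf_dvd_of_pow_eq_one
        rw [← Subgroup.coe_pow, hk, Subgroup.coe_one]
      have := eq_one_of_commute_notMem hm hx (hQN y y.2) hc (by
        rw [hma]
        exact Nat.Coprime.coprime_dvd_right hyq
          (Nat.Coprime.pow _ _ ((Nat.coprime_primes hp hq).2 hpq)))
      exact Subtype.ext this
    · rintro rfl g
      exact map_one (f g)
  rw [hfix, hcard] at hmod
  simpa using hmod

theorem false_of_conj_eq_self_or_inv {m a : ℕ} (hma : m = 2 ^ a) (hm : ∀ x ∉ N, orderOf x = m)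
    {x t i : G} (hx : x ∉ N) (ht : t ∈ N) (hi : i ∈ N) (ht1 : t ≠ 1) (hto : Odd (orderOf t))
    (hit : i * t * i⁻¹ = t⁻¹) (hxt : x * t * x⁻¹ = t ∨ x * t * x⁻¹ = t⁻¹) : False := by
  have hcop : m.Coprime (orderOf t) := by
    rw [hma]
    exact (Nat.coprime_two_left.2 hto).pow_left a
  rcases hxt with h | h
  · exact ht1 (eq_one_of_commute_notMem hm hx ht (mul_inv_eq_iff_eq_mul.1 h) hcop)
  · refine ht1 (eq_one_of_commute_notMem hm (x := i * x)
      (fun h => hx ((N.mul_mem_cancel_left hi).1 h)) ht (mul_inv_eq_iff_eq_mul.1 ?_) hcop)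
    calc i * x * t * (i * x)⁻¹ = i * (x * t * x⁻¹) * i⁻¹ := by group
      _ = (i * t * i⁻¹)⁻¹ := by rw [h]; group
      _ = t := by rw [hit, inv_inv]

omit [Finite G] in
theorem conj_pow_pow_eq {x t : G} {j : ℕ} (h : x * t * x⁻¹ = t ^ j) (k : ℕ) :
    x ^ k * t * (x ^ k)⁻¹ = t ^ j ^ k := by
  induction k with
  | zero => simp
  | succ k ih =>
    calc x ^ (k + 1) * t * (x ^ (k + 1))⁻¹ = x ^ k * (x * t * x⁻¹) * (x ^ k)⁻¹ := by
          rw [pow_succ]; group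
      _ = (x ^ k * t * (x ^ k)⁻¹) ^ j := by rw [h, conj_pow]
      _ = t ^ j ^ (k + 1) := by rw [ih, ← pow_mul, pow_succ]

end Outside

theorem factorization_eq_of_eq_pow_mul {n q k c : ℕ} (hq : q.Prime) (h : n = q ^ k * c)
    (hc : ¬ q ∣ c) : n.factorization q = k := by
  have hc0 : c ≠ 0 := by
    rintro rfl
    exact hc (dvd_zero q)
  rw [h, Nat.factorization_mul (pow_ne_zero k hq.ne_zero) hc0, Finsupp.add_apply,
    hq.factorization_pow, Finsupp.single_eq_same, Nat.factorization_eq_zero_of_not_dvd hc, add_zero]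

section Even

variable {G : Type*} [Group G] [Finite G] {N : Subgroup G}

theorem eq_two_pow_of_forall_orderOf_eq [N.Normal] (hN : N ≠ ⊤)
    (h2 : (Nat.card N).factorization 2 = 3)
    (h3 : (Nat.card N).factorization 3 = 1 ∨ (Nat.card N).factorization 3 = 2)
    {m : ℕ} (hm : ∀ x ∉ N, orderOf x = m) :
    (∃ a, m = 2 ^ a) ∧ ∀ x ∉ N, x ^ 2 ∈ N := by
  obtain ⟨p, hp, ⟨a, ha⟩, hpow⟩ := exists_prime_pow_of_forall_orderOf_eq hN hm
  obtain rfl : p = 2 := by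
    by_contra hp2
    have h8 := pow_factorization_modEq_one hN hp Nat.prime_two hp2 ha hm
    rw [h2] at h8
    have h7 : p ∣ 7 := (Nat.modEq_iff_dvd' (by norm_num)).1 h8.symm
    obtain rfl : p = 7 := (Nat.prime_dvd_prime_iff_eq hp (by norm_num)).1 h7
    have h9 := pow_factorization_modEq_one hN hp Nat.prime_three (by norm_num) ha hm
    rcases h3 with h3 | h3 <;> rw [h3] at h9 <;> revert h9 <;> decide
  exact ⟨⟨a, ha⟩, hpow⟩

theorem not_forall_orderOf_eq_of_inverted [N.Normal] (hN : N ≠ ⊤)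
    (h2 : (Nat.card N).factorization 2 = 3)
    (h3 : (Nat.card N).factorization 3 = 1 ∨ (Nat.card N).factorization 3 = 2)
    {q : ℕ} (hq : q = 3 ∨ q = 7) (hqN : (Nat.card N).factorization q = 1)
    {t i : G} (ht : t ∈ N) (hi : i ∈ N) (hto : orderOf t = q) (hit : i * t * i⁻¹ = t⁻¹) (m : ℕ) :
    ¬ ∀ x ∉ N, orderOf x = m := by
  intro hm
  obtain ⟨⟨a, ha⟩, hsq⟩ := eq_two_pow_of_forall_orderOf_eq hN h2 h3 hm
  have : Fact q.Prime := ⟨by rcases hq with rfl | rfl <;> norm_num⟩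
  obtain ⟨x, hx, j, hj⟩ := exists_conj_eq_pow hN hqN ht hto
  have hx3 : x ^ 3 ∉ N := fun h => hx (by
    rw [pow_succ] at h
    exact (N.mul_mem_cancel_left (hsq x hx)).1 h)
  have hj3 := conj_pow_pow_eq hj 3
  have ht1 : t ≠ 1 := by
    rintro rfl
    rw [orderOf_one] at hto
    rcases hq with rfl | rfl <;> simp at hto
  have hodd : Odd (orderOf t) := by
    rw [hto]
    rcases hq with rfl | rfl <;> decide
  have hcase : j ^ 3 % q = 0 ∨ j ^ 3 % q = 1 ∨ j ^ 3 % q = q - 1 := by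
    rcases hq with rfl | rfl
    · have := Nat.mod_lt j (show 3 > 0 by norm_num)
      rw [Nat.pow_mod]
      interval_cases j % 3 <;> simp
    · have := Nat.mod_lt j (show 7 > 0 by norm_num)
      rw [Nat.pow_mod]
      interval_cases j % 7 <;> simp
  rw [← pow_mod_orderOf t, hto] at hj3
  refine false_of_conj_eq_self_or_inv ha hm hx3 ht hi ht1 hodd hit ?_
  rcases hcase with h | h | h <;> rw [h] at hj3
  · rw [pow_zero, mul_inv_eq_one, mul_eq_left] at hj3
    exact absurd hj3 ht1
  · exact Or.inl (by rw [hj3, pow_one])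
  · refine Or.inr (hj3.trans (eq_inv_of_mul_eq_one_left ?_))
    rw [← pow_succ, Nat.sub_add_cancel (Fact.out : q.Prime).one_le, ← hto, pow_orderOf_eq_one]

end Even

section Transfer

variable {G A : Type*} [Group G] [Group A] {φ : A →* G}

theorem exists_mem_range_orderOf (hφ : Function.Injective φ) {k : ℕ}
    (h : ∃ a : A, orderOf a = k) : ∃ g ∈ φ.range, orderOf g = k := by
  obtain ⟨a, ha⟩ := h
  exact ⟨φ a, ⟨a, rfl⟩, by rw [orderOf_injective φ hφ, ha]⟩

theorem natCard_range (hφ : Function.Injective φ) : Nat.card φ.range = Nat.card A :=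
  (Nat.card_congr (MonoidHom.ofInjective hφ).toEquiv).symm

theorem exists_conj_map_eq [hn : φ.range.Normal] (x : G) (a : A) :
    ∃ b, x * φ a * x⁻¹ = φ b := by
  obtain ⟨b, hb⟩ := hn.conj_mem (φ a) ⟨a, rfl⟩ x
  exact ⟨b, hb.symm⟩

end Transfer

/-! ### The alternating group of degree six -/

namespace AlternatingSix

/-- The permutation `(0 1 2 3)(4 5)`. -/
def r : alternatingGroup (Fin 6) :=
  ⟨c[0, 1, 2, 3] * c[4, 5], Equiv.Perm.mem_alternatingGroup.2 (by decide)⟩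

/-- The permutation `(0 2)(4 5)`. -/
def s : alternatingGroup (Fin 6) :=
  ⟨c[0, 2] * c[4, 5], Equiv.Perm.mem_alternatingGroup.2 (by decide)⟩

/-- The permutation `(0 1 2 3 4)`. -/
def t : alternatingGroup (Fin 6) :=
  ⟨c[0, 1, 2, 3, 4], Equiv.Perm.mem_alternatingGroup.2 (by decide)⟩

/-- The permutation `(1 4)(2 3)`. -/
def i : alternatingGroup (Fin 6) :=
  ⟨c[1, 4] * c[2, 3], Equiv.Perm.mem_alternatingGroup.2 (by decide)⟩

theorem pow_five_of_commute (g : alternatingGroup (Fin 6)) (h : g * t = t * g) : g ^ 5 = 1 :=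
  Subtype.ext ((by decide +kernel : ∀ g : Equiv.Perm (Fin 6), g * t = t * g → g ^ 5 = 1) g
    (congrArg Subtype.val h))

theorem card_support_eq_four (g : alternatingGroup (Fin 6)) (h2 : g ^ 2 = 1) (h1 : g ≠ 1) :
    (g : Equiv.Perm (Fin 6)).support.card = 4 :=
  (by decide +kernel : ∀ g : Equiv.Perm (Fin 6), g ^ 2 = 1 → g ≠ 1 → Equiv.Perm.sign g = 1 →
    g.support.card = 4) g (congrArg Subtype.val h2) (fun e => h1 (Subtype.ext e)) g.2

theorem exists_conj_involution (g : alternatingGroup (Fin 6)) (h2 : g ^ 2 = 1) (h1 : g ≠ 1) :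
    ∃ h, h * g = r ^ 2 * h := by
  have hcycle : ∀ g : alternatingGroup (Fin 6), g ^ 2 = 1 → g ≠ 1 →
      (g : Equiv.Perm (Fin 6)).cycleType = Multiset.replicate 2 2 := by
    intro g h2 h1
    have hrep := Equiv.Perm.cycleType_of_pow_prime_eq_one (p := 2)
      (show (g : Equiv.Perm (Fin 6)) ^ 2 = 1 from congrArg Subtype.val h2)
    have hsum := Equiv.Perm.sum_cycleType (g : Equiv.Perm (Fin 6))
    rw [card_support_eq_four g h2 h1, hrep, Multiset.sum_replicate, smul_eq_mul] at hsum
    rw [hrep]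
    congr 1
    omega
  have hconj : IsConj g (r ^ 2) := by
    refine alternatingGroup.isConj_of (Equiv.Perm.isConj_of_cycleType_eq ?_) ?_
    · rw [hcycle g h2 h1, hcycle (r ^ 2) (by decide +kernel) (by decide +kernel)]
    · rw [card_support_eq_four g h2 h1, Fintype.card_fin]
  obtain ⟨h, hh⟩ := isConj_iff.1 hconj
  exact ⟨h, by rw [← hh, inv_mul_cancel_right]⟩

theorem eq_or_eq_inv_of_sq (g : alternatingGroup (Fin 6)) (h : g ^ 2 = r ^ 2) :
    g = r ∨ g = r⁻¹ :=
  ((by decide +kernel : ∀ g : Equiv.Perm (Fin 6), g ^ 2 = r ^ 2 → Equiv.Perm.sign g = 1 →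
    g = r ∨ g = (r : Equiv.Perm (Fin 6))⁻¹) g (congrArg Subtype.val h) g.2).imp
    Subtype.ext Subtype.ext

theorem exists_conj_reflection (g : alternatingGroup (Fin 6)) (h2 : g ^ 2 = 1)
    (hg : g * r * g⁻¹ = r⁻¹) :
    ∃ k : Fin 4, r ^ (k : ℕ) * g * (r ^ (k : ℕ))⁻¹ = s ∨
      r ^ (k : ℕ) * g * (r ^ (k : ℕ))⁻¹ = s * r :=
  ((by decide +kernel : ∀ g : Equiv.Perm (Fin 6), g ^ 2 = 1 →
    g * r * g⁻¹ = (r : Equiv.Perm (Fin 6))⁻¹ → Equiv.Perm.sign g = 1 → ∃ k : Fin 4,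
      (r : Equiv.Perm (Fin 6)) ^ (k : ℕ) * g * ((r : Equiv.Perm (Fin 6)) ^ (k : ℕ))⁻¹ = s ∨
      (r : Equiv.Perm (Fin 6)) ^ (k : ℕ) * g * ((r : Equiv.Perm (Fin 6)) ^ (k : ℕ))⁻¹ = s * r) g
    (congrArg Subtype.val h2) (congrArg Subtype.val hg) g.2).imp
    fun _ => Or.imp Subtype.ext Subtype.ext

theorem eq_sq_of_commute (g : alternatingGroup (Fin 6)) (hg : g * r = r * g) (h2 : g ^ 2 = 1)
    (h1 : g ≠ 1) : g = r ^ 2 :=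
  Subtype.ext ((by decide +kernel : ∀ g : Equiv.Perm (Fin 6), g ^ 2 = 1 → g * r = r * g →
    g ≠ 1 → Equiv.Perm.sign g = 1 → g = r ^ 2) g (congrArg Subtype.val h2)
    (congrArg Subtype.val hg) (fun e => h1 (Subtype.ext e)) g.2)

variable {G : Type*} [Group G] [Finite G] {φ : alternatingGroup (Fin 6) →* G}

theorem orderOf_t : orderOf t = 5 :=
  have : Fact (Nat.Prime 5) := ⟨by norm_num⟩
  orderOf_eq_prime (by decide +kernel) (by decide +kernel)

theorem natCard : Nat.card (alternatingGroup (Fin 6)) = 360 := by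
  rw [nat_card_alternatingGroup, Nat.card_fin]
  rfl

theorem forall_orderOf_eq_four (hφ : Function.Injective φ) [φ.range.Normal] (hN : φ.range ≠ ⊤)
    {m : ℕ} (hm : ∀ x ∉ φ.range, orderOf x = m) : m = 4 ∧ ∀ x ∉ φ.range, x ^ 2 ∈ φ.range := by
  have hcard := (natCard_range hφ).trans natCard
  obtain ⟨⟨a, ha⟩, hsq⟩ := eq_two_pow_of_forall_orderOf_eq hN
    (hcard ▸ factorization_eq_of_eq_pow_mul (c := 45) (by norm_num) rfl (by norm_num))
    (Or.inr (hcard ▸ factorization_eq_of_eq_pow_mul (c := 40) (by norm_num) rfl (by norm_num))) hm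
  refine ⟨?_, hsq⟩
  have hto : orderOf (φ t) = 5 := by rw [orderOf_injective φ hφ, orderOf_t]
  have : Fact (Nat.Prime 5) := ⟨by norm_num⟩
  obtain ⟨x, hx, j, hj⟩ := exists_conj_eq_pow hN
    (hcard ▸ factorization_eq_of_eq_pow_mul (c := 72) (by norm_num) rfl (by norm_num)) ⟨t, rfl⟩ hto
  have ht1 : φ t ≠ 1 := by
    intro h
    rw [h, orderOf_one] at hto
    simp at hto
  have hj2 := conj_pow_pow_eq hj 2
  have hj4 := conj_pow_pow_eq hj 4
  rw [← pow_mod_orderOf (φ t), hto, Nat.pow_mod] at hj2 hj4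
  rw [← pow_mod_orderOf (φ t), hto] at hj
  have hinv : φ i * φ t * (φ i)⁻¹ = (φ t)⁻¹ := by
    rw [← map_inv, ← map_inv, ← map_mul, ← map_mul]
    exact congrArg φ (by decide +kernel)
  have hsmall : ¬ (x * φ t * x⁻¹ = φ t ∨ x * φ t * x⁻¹ = (φ t)⁻¹) := fun h =>
    false_of_conj_eq_self_or_inv ha hm hx ⟨t, rfl⟩ ⟨i, rfl⟩ ht1 (by rw [hto]; decide) hinv h
  have ht4 : φ t ^ 4 = (φ t)⁻¹ := by
    apply eq_inv_of_mul_eq_one_left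
    rw [← pow_succ]
    exact orderOf_dvd_iff_pow_eq_one.1 hto.dvd
  have hfour : j % 5 = 2 ∨ j % 5 = 3 := by
    have := Nat.mod_lt j (show 5 > 0 by norm_num)
    interval_cases h : j % 5
    · rw [pow_zero, mul_inv_eq_one, mul_eq_left] at hj
      exact absurd hj ht1
    · exact absurd (Or.inl (by rw [hj, pow_one])) hsmall
    · exact Or.inl rfl
    · exact Or.inr rfl
    · exact absurd (Or.inr (by rw [hj, ht4])) hsmall
  have hj2' : x ^ 2 * φ t * (x ^ 2)⁻¹ = (φ t)⁻¹ := by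
    rw [hj2, ← ht4]
    rcases hfour with h | h <;> rw [h]
  have hj4' : x ^ 4 * φ t * (x ^ 4)⁻¹ = φ t := by
    rw [hj4]
    rcases hfour with h | h <;> rw [h] <;> exact pow_one _
  obtain ⟨b, hb⟩ := hsq x hx
  have hb4 : φ (b ^ 2) = x ^ 4 := by rw [map_pow, hb, ← pow_mul]
  have hb5 : (b ^ 2) ^ 5 = 1 := by
    apply pow_five_of_commute
    apply hφ
    rw [map_mul, map_mul, hb4]
    exact mul_inv_eq_iff_eq_mul.1 hj4'
  have h20 : orderOf x ∣ 20 := by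
    apply orderOf_dvd_of_pow_eq_one
    rw [show 20 = 4 * 5 from rfl, pow_mul, ← hb4, ← map_pow, hb5, map_one]
  have hn2 : ¬ orderOf x ∣ 2 := by
    intro h
    rw [orderOf_dvd_iff_pow_eq_one.1 h, one_mul, inv_one, mul_one, ← ht4] at hj2'
    have h3 : φ t ^ 3 = 1 := by
      rw [pow_succ (φ t) 3] at hj2'
      exact right_eq_mul.1 hj2'
    have := orderOf_dvd_of_pow_eq_one h3
    rw [hto] at this
    revert this
    decide
  rw [hm x hx] at h20 hn2
  have hm4 : m ∣ 4 := by
    rw [ha] at h20 ⊢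
    exact Nat.Coprime.dvd_of_dvd_mul_right (Nat.Coprime.pow_left a (by norm_num : Nat.Coprime 2 5))
      (by simpa using h20)
  have := Nat.le_of_dvd (by norm_num) hm4
  interval_cases m <;> revert hm4 hn2 <;> decide

omit [Finite G] in
theorem exists_notMem_normalized_dihedral (hφ : Function.Injective φ) [hn : φ.range.Normal]
    (hN : φ.range ≠ ⊤) : ∃ y ∉ φ.range, y * φ r * y⁻¹ = φ r ∧
      (y * φ s * y⁻¹ = φ s ∨ y * φ s * y⁻¹ = φ (s * r)) := by
  have hmul : ∀ (h : alternatingGroup (Fin 6)) {y : G}, y ∉ φ.range → φ h * y ∉ φ.range :=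
    fun h y hy hhy => hy ((φ.range.mul_mem_cancel_left ⟨h, rfl⟩).1 hhy)
  have hconj : ∀ (h : alternatingGroup (Fin 6)) (y g : G),
      φ h * y * g * (φ h * y)⁻¹ = φ h * (y * g * y⁻¹) * (φ h)⁻¹ := by
    intro h y g
    group
  have hφi : ∀ g, φ g = 1 → g = 1 := fun g hg => hφ (hg.trans (map_one φ).symm)
  obtain ⟨x, hx⟩ := exists_notMem_of_ne_top hN
  obtain ⟨z, hz⟩ := exists_conj_map_eq (φ := φ) x (r ^ 2)
  obtain ⟨h, hh⟩ := exists_conj_involution z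
    (hφi _ (by
      rw [map_pow, ← hz, conj_pow, ← map_pow, show (r ^ 2) ^ 2 = 1 by decide +kernel]
      simp))
    (by
      rintro rfl
      rw [map_one, mul_inv_eq_one, mul_eq_left] at hz
      exact absurd (hφi _ hz) (by decide +kernel))
  obtain ⟨y, hy, hyr⟩ : ∃ y ∉ φ.range, y * φ r * y⁻¹ = φ r := by
    have hy : φ h * x ∉ φ.range := hmul h hx
    have hyz : φ h * x * φ (r ^ 2) * (φ h * x)⁻¹ = φ (r ^ 2) := by
      rw [hconj, hz, ← map_mul, hh, map_mul, mul_inv_cancel_right]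
    obtain ⟨r', hr'⟩ := exists_conj_map_eq (φ := φ) (φ h * x) r
    rcases eq_or_eq_inv_of_sq r' (hφ (by rw [map_pow, ← hr', conj_pow, ← map_pow, hyz]))
      with rfl | rfl
    · exact ⟨_, hy, hr'⟩
    · refine ⟨_, hmul s hy, ?_⟩
      rw [hconj, hr', ← map_inv, ← map_mul, ← map_mul]
      exact congrArg φ (by decide +kernel)
  obtain ⟨s', hs'⟩ := exists_conj_map_eq (φ := φ) y s
  obtain ⟨k, hk⟩ := exists_conj_reflection s'
    (hφi _ (by
      rw [map_pow, ← hs', conj_pow, ← map_pow, show s ^ 2 = 1 by decide +kernel]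
      simp))
    (hφ (by
      have h1 : s * r * s⁻¹ = r⁻¹ := by decide +kernel
      rw [map_mul, map_mul, map_inv, map_inv, ← hs']
      nth_rewrite 1 [← hyr]
      calc y * φ s * y⁻¹ * (y * φ r * y⁻¹) * (y * φ s * y⁻¹)⁻¹
          = y * (φ s * φ r * (φ s)⁻¹) * y⁻¹ := by group
        _ = (y * φ r * y⁻¹)⁻¹ := by
          rw [← map_inv, ← map_mul, ← map_mul, h1, map_inv]
          group
        _ = (φ r)⁻¹ := by rw [hyr]))
  refine ⟨φ (r ^ (k : ℕ)) * y, hmul _ hy, ?_, ?_⟩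
  · rw [hconj, hyr, ← map_inv, ← map_mul, ← map_mul]
    exact congrArg φ (by group)
  · rw [hconj, hs', ← map_inv, ← map_mul, ← map_mul]
    exact hk.imp (congrArg φ) (congrArg φ)

theorem not_forall_orderOf_eq (hφ : Function.Injective φ) [hn : φ.range.Normal]
    (hN : φ.range ≠ ⊤) (m : ℕ) : ¬ ∀ x ∉ φ.range, orderOf x = m := by
  intro hm
  obtain ⟨rfl, hsq⟩ := forall_orderOf_eq_four hφ hN hm
  have hmul : ∀ {y : G}, y ∉ φ.range → ∀ h : alternatingGroup (Fin 6), y * φ h ∉ φ.range :=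
    fun hy h hyh => hy ((φ.range.mul_mem_cancel_right ⟨h, rfl⟩).1 hyh)
  have hφi : ∀ g, φ g = 1 → g = 1 := fun g hg => hφ (hg.trans (map_one φ).symm)
  have h4 : ∀ x ∉ φ.range, x ^ 4 = 1 := fun x hx => by rw [← hm x hx, pow_orderOf_eq_one]
  have h2 : ∀ x ∉ φ.range, x ^ 2 ≠ 1 := fun x hx h => by
    have := orderOf_dvd_of_pow_eq_one h
    rw [hm x hx] at this
    revert this
    decide
  obtain ⟨y, hy, hyr, hys⟩ := exists_notMem_normalized_dihedral hφ hN
  obtain ⟨b, hb⟩ := hsq y hy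
  have hcr : Commute y (φ r) := mul_inv_eq_iff_eq_mul.1 hyr
  obtain rfl : b = r ^ 2 := by
    apply eq_sq_of_commute
    · apply hφ
      rw [map_mul, map_mul, hb]
      exact hcr.pow_left 2
    · apply hφi
      rw [map_pow, hb, ← pow_mul]
      exact h4 y hy
    · rintro rfl
      rw [map_one] at hb
      exact h2 y hy hb.symm
  rcases hys with hys | hys
  · apply h2 _ (hmul hy r)
    rw [hcr.mul_pow, ← hb, ← map_pow, ← map_mul, show r ^ 2 * r ^ 2 = 1 by decide +kernel, map_one]
  · have hsq' : (y * φ s) ^ 2 = φ (s * r * r ^ 2 * s) := by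
      calc (y * φ s) ^ 2 = (y * φ s * y⁻¹) * y ^ 2 * φ s := by simp [pow_two, mul_assoc]
        _ = φ (s * r * r ^ 2 * s) := by rw [hys, ← hb, ← map_mul, ← map_mul]
    have := h4 _ (hmul hy s)
    rw [show 4 = 2 * 2 from rfl, pow_mul, hsq', ← map_pow] at this
    exact absurd (hφi _ this) (by decide +kernel)

theorem seven_le_omegaAut (hφ : Function.Injective φ) [φ.range.Characteristic]
    (hN : φ.range ≠ ⊤) : 7 ≤ omegaAut G := by
  refine seven_le_omegaAut_of_five_orders {1, 2, 3, 4, 5} rfl ?_ (not_forall_orderOf_eq hφ hN)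
  intro k hk
  apply exists_mem_range_orderOf hφ
  simp only [Finset.mem_insert, Finset.mem_singleton] at hk
  rcases hk with rfl | rfl | rfl | rfl | rfl
  · exact ⟨1, orderOf_one⟩
  · exact ⟨s, orderOf_eq_prime (by decide +kernel) (by decide +kernel)⟩
  · exact exists_prime_orderOf_dvd_card' 3 (by rw [natCard]; norm_num)
  · exact ⟨r, orderOf_eq_prime_pow (p := 2) (n := 1) (by decide +kernel) (by decide +kernel)⟩
  · exact ⟨t, orderOf_t⟩

end AlternatingSix

/-! ### The alternating group of degree five -/

namespace AlternatingFive

/-- The permutation `(0 1 2)`. -/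
def t : alternatingGroup (Fin 5) :=
  ⟨c[0, 1, 2], Equiv.Perm.mem_alternatingGroup.2 (by decide)⟩

/-- The permutation `(0 3)(1 4)`. -/
def w : alternatingGroup (Fin 5) :=
  ⟨c[0, 3] * c[1, 4], Equiv.Perm.mem_alternatingGroup.2 (by decide)⟩

/-- The permutation `(0 4)(1 3)`, the conjugate of `w` under the transposition `(3 4)`. -/
def w' : alternatingGroup (Fin 5) :=
  ⟨c[0, 4] * c[1, 3], Equiv.Perm.mem_alternatingGroup.2 (by decide)⟩

/-- The permutation `(0 1)(3 4)`. -/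
def i : alternatingGroup (Fin 5) :=
  ⟨c[0, 1] * c[3, 4], Equiv.Perm.mem_alternatingGroup.2 (by decide)⟩

theorem eq_one_of_commute : ∀ g, g * t = t * g → g * w = w * g → g = 1 := by decide +kernel

theorem exists_conj_involution : ∀ g, g ^ 2 = 1 → g ≠ 1 → (t * g) ^ 5 = 1 →
    ∃ k : Fin 3, t ^ (k : ℕ) * g * (t ^ (k : ℕ))⁻¹ = w ∨
      t ^ (k : ℕ) * g * (t ^ (k : ℕ))⁻¹ = w' := by
  decide +kernel

theorem orderOf_t : orderOf t = 3 := orderOf_eq_prime (by decide +kernel) (by decide +kernel)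

theorem orderOf_w : orderOf w = 2 := orderOf_eq_prime (by decide +kernel) (by decide +kernel)

theorem orderOf_t_mul_w : orderOf (t * w) = 5 :=
  have : Fact (Nat.Prime 5) := ⟨by norm_num⟩
  orderOf_eq_prime (by decide +kernel) (by decide +kernel)

theorem natCard : Nat.card (alternatingGroup (Fin 5)) = 60 := by
  rw [nat_card_alternatingGroup, Nat.card_fin]
  rfl

variable {G : Type*} [Group G] [Finite G] {φ : alternatingGroup (Fin 5) →* G}

theorem seven_le_omegaAut_of_three_orders (hφ : Function.Injective φ) [φ.range.Characteristic]
    (B : Finset ℕ) (hB3 : B.card = 3) (hB : ∀ b ∈ B, ∃ g ∉ φ.range, orderOf g = b) :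
    7 ≤ omegaAut G := by
  have := card_add_card_le_omegaAut φ.range {1, 2, 3, 5} B (by
    intro k hk
    apply exists_mem_range_orderOf hφ
    simp only [Finset.mem_insert, Finset.mem_singleton] at hk
    rcases hk with rfl | rfl | rfl | rfl
    · exact ⟨1, orderOf_one⟩
    · exact ⟨w, orderOf_w⟩
    · exact ⟨t, orderOf_t⟩
    · exact ⟨t * w, orderOf_t_mul_w⟩) hB
  rwa [hB3] at this

theorem seven_le_omegaAut_of_centralizing (hφ : Function.Injective φ) [φ.range.Characteristic]
    {c : G} (hc : c ∉ φ.range) (hct : Commute c (φ t)) (hcw : Commute c (φ w)) :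
    7 ≤ omegaAut G := by
  have hc1 : orderOf c ≠ 1 := by
    intro h
    rw [orderOf_eq_one_iff] at h
    exact hc (h ▸ φ.range.one_mem)
  obtain ⟨p, hp, hpc⟩ := Nat.exists_prime_and_dvd hc1
  set d := c ^ (orderOf c / p)
  have hdp : orderOf d = p := orderOf_pow_orderOf_div (orderOf_pos c).ne' hpc
  have hdt : Commute d (φ t) := hct.pow_left _
  have hdw : Commute d (φ w) := hcw.pow_left _
  have hd : d ∉ φ.range := by
    rintro ⟨b, hb⟩
    have : b = 1 := eq_one_of_commute b (hφ (by rw [map_mul, map_mul, hb]; exact hdt))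
      (hφ (by rw [map_mul, map_mul, hb]; exact hdw))
    rw [← hb, this, map_one, orderOf_one] at hdp
    exact hp.one_lt.ne hdp
  have key : ∀ g : alternatingGroup (Fin 5), Commute d (φ g) → p.Coprime (orderOf g) →
      ∃ x ∉ φ.range, orderOf x = p * orderOf g := by
    intro g hg hpg
    refine ⟨d * φ g, fun h => hd ((φ.range.mul_mem_cancel_right ⟨g, rfl⟩).1 h), ?_⟩
    rw [← orderOf_injective φ hφ] at hpg
    rw [hg.orderOf_mul_eq_mul_orderOf_of_coprime (by rwa [hdp]), hdp, orderOf_injective φ hφ]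
  have two : ∀ g h : alternatingGroup (Fin 5), Commute d (φ g) → Commute d (φ h) →
      p.Coprime (orderOf g) → p.Coprime (orderOf h) → orderOf g ≠ 1 → orderOf h ≠ 1 →
      orderOf g ≠ orderOf h → 7 ≤ omegaAut G := by
    intro g h hg hh hpg hph hg1 hh1 hgh
    refine seven_le_omegaAut_of_three_orders hφ {p, p * orderOf g, p * orderOf h} ?_ ?_
    · have h1 : p ≠ p * orderOf g := fun e => hg1 (Nat.eq_of_mul_eq_mul_left hp.pos (by omega))
      have h2 : p ≠ p * orderOf h := fun e => hh1 (Nat.eq_of_mul_eq_mul_left hp.pos (by omega))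
      have h3 : p * orderOf g ≠ p * orderOf h := fun e => hgh (Nat.eq_of_mul_eq_mul_left hp.pos e)
      exact Finset.card_eq_three.2 ⟨_, _, _, h1, h2, h3, rfl⟩
    · intro b hb
      simp only [Finset.mem_insert, Finset.mem_singleton] at hb
      rcases hb with rfl | rfl | rfl
      · exact ⟨d, hd, hdp⟩
      · exact key g hg hpg
      · exact key h hh hph
  have hdtw : Commute d (φ (t * w)) := by
    rw [map_mul]
    exact hdt.mul_right hdw
  by_cases hp2 : p = 2
  · subst hp2
    exact two t (t * w) hdt hdtw (by rw [orderOf_t]; norm_num) (by rw [orderOf_t_mul_w]; norm_num)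
      (by rw [orderOf_t]; norm_num) (by rw [orderOf_t_mul_w]; norm_num)
      (by rw [orderOf_t, orderOf_t_mul_w]; norm_num)
  · have hw : p.Coprime (orderOf w) := by
      rw [orderOf_w]
      exact (Nat.coprime_primes hp Nat.prime_two).2 hp2
    by_cases hp3 : p = 3
    · subst hp3
      exact two w (t * w) hdw hdtw hw (by rw [orderOf_t_mul_w]; norm_num)
        (by rw [orderOf_w]; norm_num) (by rw [orderOf_t_mul_w]; norm_num)
        (by rw [orderOf_w, orderOf_t_mul_w]; norm_num)
    · exact two w t hdw hdt hw
        (by rw [orderOf_t]; exact (Nat.coprime_primes hp Nat.prime_three).2 hp3)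
        (by rw [orderOf_w]; norm_num) (by rw [orderOf_t]; norm_num)
        (by rw [orderOf_w, orderOf_t]; norm_num)

theorem exists_notMem_conj_eq (hφ : Function.Injective φ) [φ.range.Normal] (hN : φ.range ≠ ⊤) :
    ∃ y ∉ φ.range, Commute y (φ t) ∧
      (y * φ w * y⁻¹ = φ w ∨ y * φ w * y⁻¹ = φ w') := by
  have hmul : ∀ (h : alternatingGroup (Fin 5)) {y : G}, y ∉ φ.range → φ h * y ∉ φ.range :=
    fun h y hy hhy => hy ((φ.range.mul_mem_cancel_left ⟨h, rfl⟩).1 hhy)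
  have hconj : ∀ (h : alternatingGroup (Fin 5)) (y g : G),
      φ h * y * g * (φ h * y)⁻¹ = φ h * (y * g * y⁻¹) * (φ h)⁻¹ := by
    intro h y g
    group
  have hφi : ∀ g, φ g = 1 → g = 1 := fun g hg => hφ (hg.trans (map_one φ).symm)
  have hto : orderOf (φ t) = 3 := by rw [orderOf_injective φ hφ, orderOf_t]
  obtain ⟨y, hy, hyt⟩ : ∃ y ∉ φ.range, y * φ t * y⁻¹ = φ t := by
    obtain ⟨x, hx, j, hj⟩ := exists_conj_eq_pow hN
      (((natCard_range hφ).trans natCard) ▸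
        factorization_eq_of_eq_pow_mul (c := 20) Nat.prime_three rfl (by norm_num)) ⟨t, rfl⟩ hto
    rw [← pow_mod_orderOf (φ t), hto] at hj
    have := Nat.mod_lt j (show 3 > 0 by norm_num)
    interval_cases j % 3
    · rw [pow_zero, mul_inv_eq_one, mul_eq_left] at hj
      exact absurd (hφi _ hj) (by decide +kernel)
    · exact ⟨x, hx, by rw [hj, pow_one]⟩
    · refine ⟨_, hmul i hx, ?_⟩
      rw [hconj, hj, ← map_pow, ← map_inv, ← map_mul, ← map_mul]
      exact congrArg φ (by decide +kernel)
  obtain ⟨g, hg⟩ := exists_conj_map_eq (φ := φ) y w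
  obtain ⟨k, hk⟩ := exists_conj_involution g
    (hφi _ (by
      rw [map_pow, ← hg, conj_pow, ← map_pow, show w ^ 2 = 1 by decide +kernel]
      simp))
    (by
      rintro rfl
      rw [map_one, mul_inv_eq_one, mul_eq_left] at hg
      exact absurd (hφi _ hg) (by decide +kernel))
    (hφi _ (by
      rw [map_pow, map_mul, ← hg]
      nth_rewrite 1 [← hyt]
      rw [conj_mul, conj_pow, ← map_mul, ← map_pow, show (t * w) ^ 5 = 1 by decide +kernel]
      simp))
  refine ⟨φ (t ^ (k : ℕ)) * y, hmul _ hy, mul_inv_eq_iff_eq_mul.1 ?_, ?_⟩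
  · rw [hconj, hyt, ← map_inv, ← map_mul, ← map_mul]
    exact congrArg φ (by group)
  · rw [hconj, hg, ← map_inv, ← map_mul, ← map_mul]
    exact hk.imp (congrArg φ) (congrArg φ)

omit [Finite G] in
theorem conj_map_w' {y : G} (ht : Commute y (φ t)) (hw : y * φ w * y⁻¹ = φ w') :
    y * φ w' * y⁻¹ = φ w := by
  have ht' : MulAut.conj y (φ t) = φ t := mul_inv_eq_iff_eq_mul.2 ht
  have hw' : MulAut.conj y (φ w) = φ w' := hw
  have h1 : w' = t * w * t * t * w * t * w * t * t * w * t := by decide +kernel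
  have h2 : t * w' * t * t * w' * t * w' * t * t * w' * t = w := by decide +kernel
  have h3 : MulAut.conj y (φ w') = φ (t * w' * t * t * w' * t * w' * t * t * w' * t) := by
    conv_lhs => rw [h1]
    simp only [map_mul, ht', hw']
  rwa [h2] at h3

theorem seven_le_omegaAut (hφ : Function.Injective φ) [φ.range.Characteristic]
    (hN : φ.range ≠ ⊤) : 7 ≤ omegaAut G := by
  obtain ⟨y, hy, hyt, hyw | hyw⟩ := exists_notMem_conj_eq hφ hN
  · exact seven_le_omegaAut_of_centralizing hφ hy hyt (mul_inv_eq_iff_eq_mul.1 hyw)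
  have hyw' := conj_map_w' hyt hyw
  have hct : Commute (y ^ 2) (φ t) := hyt.pow_left 2
  have hcw : Commute (y ^ 2) (φ w) := by
    apply mul_inv_eq_iff_eq_mul.1
    calc y ^ 2 * φ w * (y ^ 2)⁻¹ = y * (y * φ w * y⁻¹) * y⁻¹ := by simp [pow_two, mul_assoc]
      _ = φ w := by rw [hyw, hyw']
  by_cases hy2 : y ^ 2 ∈ φ.range
  swap
  · exact seven_le_omegaAut_of_centralizing hφ hy2 hct hcw
  have hsq : y ^ 2 = 1 := by
    obtain ⟨b, hb⟩ := hy2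
    rw [← hb, eq_one_of_commute b (hφ (by rw [map_mul, map_mul, hb]; exact hct))
      (hφ (by rw [map_mul, map_mul, hb]; exact hcw)), map_one]
  have hyo : orderOf y = 2 :=
    orderOf_eq_prime hsq (fun h => hy (h ▸ φ.range.one_mem))
  have hmul : ∀ h : alternatingGroup (Fin 5), y * φ h ∉ φ.range :=
    fun h hyh => hy ((φ.range.mul_mem_cancel_right ⟨h, rfl⟩).1 hyh)
  have hto : orderOf (φ t) = 3 := by rw [orderOf_injective φ hφ, orderOf_t]
  refine seven_le_omegaAut_of_three_orders hφ {2, 4, 6} rfl ?_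
  intro b hb
  simp only [Finset.mem_insert, Finset.mem_singleton] at hb
  rcases hb with rfl | rfl | rfl
  · exact ⟨y, hy, hyo⟩
  · have h : (y * φ w) ^ 2 = φ (w' * w) := by
      calc (y * φ w) ^ 2 = y * φ w * y⁻¹ * y ^ 2 * φ w := by simp [pow_two, mul_assoc]
        _ = φ (w' * w) := by rw [hyw, hsq, mul_one, map_mul]
    refine ⟨_, hmul w, orderOf_eq_prime_pow (p := 2) (n := 1) ?_ ?_⟩
    · rw [pow_one, h]
      exact fun e => absurd (hφ (e.trans (map_one φ).symm)) (by decide +kernel)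
    · rw [show 2 ^ (1 + 1) = 2 * 2 from rfl, pow_mul, h, ← map_pow,
        show (w' * w) ^ 2 = 1 by decide +kernel, map_one]
  · exact ⟨_, hmul t, by
      rw [hyt.orderOf_mul_eq_mul_orderOf_of_coprime (by rw [hyo, hto]; norm_num), hyo, hto]⟩

end AlternatingFive

/-! ### The projective special linear groups -/

section ProjectiveSpecialLinear

open Matrix

theorem natCard_specialLinearGroup_mul {F : Type*} [Field F] [Finite F] (n : ℕ) [NeZero n] :
    Nat.card (SpecialLinearGroup (Fin n) F) * Nat.card Fˣ = Nat.card (GL (Fin n) F) := by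
  have hker : (SpecialLinearGroup.toGL : SpecialLinearGroup (Fin n) F →* _).range =
      (GeneralLinearGroup.det : GL (Fin n) F →* Fˣ).ker :=
    SetLike.coe_injective SpecialLinearGroup.range_toGL
  have h1 : Nat.card (SpecialLinearGroup (Fin n) F) =
      Nat.card (GeneralLinearGroup.det : GL (Fin n) F →* Fˣ).ker := by
    rw [← hker]
    exact (natCard_range SpecialLinearGroup.toGL_injective).symm
  have h2 : Nat.card Fˣ = (GeneralLinearGroup.det : GL (Fin n) F →* Fˣ).ker.index := by
    rw [Subgroup.index_ker, MonoidHom.range_eq_top.2 GeneralLinearGroup.det_surjective,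
      Subgroup.card_top]
  rw [h1, h2, Subgroup.card_mul_index]

theorem natCard_projectiveSpecialLinearGroup_two_mul {F : Type*} [Field F] [Finite F] :
    Nat.card PSL(2, F) * Nat.card (rootsOfUnity 2 F) * (Nat.card F - 1) =
      (Nat.card F ^ 2 - 1) * (Nat.card F ^ 2 - Nat.card F) := by
  have := Fintype.ofFinite F
  have h1 := natCard_specialLinearGroup_mul (F := F) 2
  rw [Nat.card_units, card_GL_field, Fin.prod_univ_two, ← Nat.card_eq_fintype_card,
    Subgroup.card_eq_card_quotient_mul_card_subgroup
      (Subgroup.center (SpecialLinearGroup (Fin 2) F)),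
    Nat.card_congr SpecialLinearGroup.center_equiv_rootsOfUnity.toEquiv] at h1
  simpa using h1

variable {R : Type*} [CommRing R] {g : SL(2, R)}

theorem mk_pow_ne_one_of_not_commute (k : ℕ) (h : SL(2, R)) (hgh : g ^ k * h ≠ h * g ^ k) :
    (g : PSL(2, R)) ^ k ≠ 1 := by
  intro e
  rw [← QuotientGroup.mk_pow, QuotientGroup.eq_one_iff] at e
  exact hgh (Subgroup.mem_center_iff.1 e h).symm

theorem mk_pow_eq_one_of_pow_eq_one {k : ℕ} (h : g ^ k = 1) : (g : PSL(2, R)) ^ k = 1 := by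
  rw [← QuotientGroup.mk_pow, h, QuotientGroup.mk_one]

theorem mk_pow_eq_one_of_pow_eq_neg_one {k : ℕ} (h : g ^ k = -1) : (g : PSL(2, R)) ^ k = 1 := by
  rw [← QuotientGroup.mk_pow, h, QuotientGroup.eq_one_iff, Subgroup.mem_center_iff]
  intro x
  rw [mul_neg, neg_mul, one_mul, mul_one]

variable {G P : Type*} [Group G] [Finite G] [Group P] {φ : P →* G}

/-- The common final step for `PSL(2,7)` and `PSL(2,8)`. -/
theorem seven_le_omegaAut_of_inverted (hφ : Function.Injective φ) [φ.range.Characteristic]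
    (hN : φ.range ≠ ⊤) (h2 : (Nat.card P).factorization 2 = 3)
    (h3 : (Nat.card P).factorization 3 = 1 ∨ (Nat.card P).factorization 3 = 2)
    {q : ℕ} (hq : q = 3 ∨ q = 7) (hqP : (Nat.card P).factorization q = 1)
    {t i : P} (hto : orderOf t = q) (hit : i * t * i⁻¹ = t⁻¹)
    (A : Finset ℕ) (hA : A.card = 5) (hAP : ∀ k ∈ A, ∃ a : P, orderOf a = k) :
    7 ≤ omegaAut G := by
  have hc := natCard_range hφ
  refine seven_le_omegaAut_of_five_orders A hA
    (fun k hk => exists_mem_range_orderOf hφ (hAP k hk))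
    (not_forall_orderOf_eq_of_inverted hN (hc ▸ h2) (hc ▸ h3) hq (hc ▸ hqP) ⟨t, rfl⟩ ⟨i, rfl⟩
      (by rw [orderOf_injective φ hφ, hto]) ?_)
  rw [← map_inv, ← map_inv, ← map_mul, ← map_mul, hit]

end ProjectiveSpecialLinear

namespace PSLTwoSeven

instance : Fact (Nat.Prime 7) := ⟨by norm_num⟩

theorem natCard : Nat.card PSL(2, ZMod 7) = 168 := by
  have h := natCard_projectiveSpecialLinearGroup_two_mul (F := ZMod 7)
  have hroots : Nat.card (rootsOfUnity 2 (ZMod 7)) = 2 :=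
    (IsPrimitiveRoot.neg_one 7 (by norm_num)).card_rootsOfUnity
  rw [hroots, Nat.card_zmod] at h
  omega

/-- An element of order three. -/
def t : SL(2, ZMod 7) := ⟨!![0, -1; 1, -1], by decide⟩

/-- An element inverting `t`. -/
def i : SL(2, ZMod 7) := ⟨!![1, 3; 4, 6], by decide⟩

/-- An element of order eight, with fourth power `-1`. -/
def u : SL(2, ZMod 7) := ⟨!![0, -1; 1, 3], by decide⟩

theorem orderOf_t : orderOf (t : PSL(2, ZMod 7)) = 3 :=
  orderOf_eq_prime (mk_pow_eq_one_of_pow_eq_one (by decide +kernel))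
    (by
      rw [← pow_one (t : PSL(2, ZMod 7))]
      exact mk_pow_ne_one_of_not_commute 1 u (by decide +kernel))

theorem orderOf_u : orderOf (u : PSL(2, ZMod 7)) = 4 :=
  orderOf_eq_prime_pow (p := 2) (n := 1)
    (mk_pow_ne_one_of_not_commute _ t (by decide +kernel))
    (mk_pow_eq_one_of_pow_eq_neg_one (by decide +kernel))

theorem seven_le_omegaAut {G : Type*} [Group G] [Finite G] {φ : PSL(2, ZMod 7) →* G}
    (hφ : Function.Injective φ) [φ.range.Characteristic] (hN : φ.range ≠ ⊤) : 7 ≤ omegaAut G := by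
  have h3 : (Nat.card PSL(2, ZMod 7)).factorization 3 = 1 :=
    natCard ▸ factorization_eq_of_eq_pow_mul (c := 56) (by norm_num) rfl (by norm_num)
  refine seven_le_omegaAut_of_inverted hφ hN
    (natCard ▸ factorization_eq_of_eq_pow_mul (c := 21) (by norm_num) rfl (by norm_num))
    (Or.inl h3) (Or.inl rfl) h3 (t := t) (i := i) orderOf_t ?_ {1, 2, 3, 4, 7} rfl ?_
  · exact congrArg (QuotientGroup.mk (s := Subgroup.center SL(2, ZMod 7)))
      (show i * t * i⁻¹ = t⁻¹ by decide +kernel)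
  · intro k hk
    simp only [Finset.mem_insert, Finset.mem_singleton] at hk
    rcases hk with rfl | rfl | rfl | rfl | rfl
    · exact ⟨1, orderOf_one⟩
    · exact exists_prime_orderOf_dvd_card' 2 (by rw [natCard]; norm_num)
    · exact ⟨t, orderOf_t⟩
    · exact ⟨u, orderOf_u⟩
    · exact exists_prime_orderOf_dvd_card' 7 (by rw [natCard]; norm_num)

end PSLTwoSeven

namespace PSLTwoEight

variable {F : Type*} [Field F] [Finite F]

theorem natCard [CharP F 2] (hF : Nat.card F = 8) : Nat.card PSL(2, F) = 504 := by
  have h := natCard_projectiveSpecialLinearGroup_two_mul (F := F)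
  have hroots : Nat.card (rootsOfUnity 2 F) = 1 := by
    rw [Nat.card_eq_one_iff_unique]
    refine ⟨⟨fun x y => Subtype.ext (Units.ext ?_)⟩, ⟨1⟩⟩
    have hx : ∀ x : rootsOfUnity 2 F, ((x : Fˣ) : F) = 1 := by
      intro x
      have h2 : ((x : Fˣ) : F) ^ 2 = 1 := (mem_rootsOfUnity' 2 (x : Fˣ)).1 x.2
      have h0 : (2 : F) = 0 := CharTwo.two_eq_zero
      have h3 : (((x : Fˣ) : F) - 1) ^ 2 = 0 := by
        linear_combination h2 + (1 - ((x : Fˣ) : F)) * h0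
      exact sub_eq_zero.1 (pow_eq_zero_iff two_ne_zero |>.1 h3)
    rw [hx, hx]
  rw [hroots, hF] at h
  omega

omit [Finite F] in
theorem exists_pow_three_eq_add_one [CharP F 2] (hF : Nat.card F = 8) : ∃ τ : F, τ ^ 3 = τ + 1 := by
  have : Finite F := Nat.finite_of_card_ne_zero (by rw [hF]; norm_num)
  have := Fintype.ofFinite F
  classical
  have h2 : (2 : F) = 0 := CharTwo.two_eq_zero
  obtain ⟨a, ha⟩ : ∃ a : F, a ∉ ({0, 1} : Finset F) := by
    by_contra! h
    have h1 := Finset.card_le_card (show Finset.univ ⊆ ({0, 1} : Finset F) from fun x _ => h x)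
    rw [Finset.card_univ, ← Nat.card_eq_fintype_card, hF] at h1
    exact absurd (h1.trans Finset.card_le_two) (by norm_num)
  simp only [Finset.mem_insert, Finset.mem_singleton, not_or] at ha
  have h7 : a ^ 7 = 1 := by
    have := FiniteField.pow_card_sub_one_eq_one a ha.1
    rwa [← Nat.card_eq_fintype_card, hF] at this
  have hprod : (a - 1) * ((a ^ 3 + a + 1) * (a ^ 3 + a ^ 2 + 1)) = 0 := by
    linear_combination h7 + (a ^ 4 - a ^ 3) * h2
  rcases mul_eq_zero.1 ((mul_eq_zero.1 hprod).resolve_left (sub_ne_zero.2 ha.2)) with h | h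
  · exact ⟨a, by linear_combination h - (a + 1) * h2⟩
  · refine ⟨a⁻¹, ?_⟩
    have := ha.1
    field_simp
    linear_combination (-1 : F) * h + h2

omit [Finite F] in
theorem exists_coe_eq {a b c d : F} (h : a * d - b * c = 1) :
    ∃ g : SL(2, F), (g : Matrix (Fin 2) (Fin 2) F) = !![a, b; c, d] :=
  ⟨⟨!![a, b; c, d], by rw [Matrix.det_fin_two_of, h]⟩, rfl⟩

omit [Finite F] in
theorem eq_of_coe_eq {a b c d a' b' c' d' : F} {g h : SL(2, F)}
    (hg : (g : Matrix (Fin 2) (Fin 2) F) = !![a, b; c, d])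
    (hh : (h : Matrix (Fin 2) (Fin 2) F) = !![a', b'; c', d'])
    (h₁ : a = a') (h₂ : b = b') (h₃ : c = c') (h₄ : d = d') : g = h := by
  apply Subtype.ext
  rw [hg, hh, h₁, h₂, h₃, h₄]

omit [Finite F] in
theorem coe_mul_eq {a b c d a' b' c' d' : F} {g h : SL(2, F)}
    (hg : (g : Matrix (Fin 2) (Fin 2) F) = !![a, b; c, d])
    (hh : (h : Matrix (Fin 2) (Fin 2) F) = !![a', b'; c', d']) :
    ((g * h : SL(2, F)) : Matrix (Fin 2) (Fin 2) F) =
      !![a * a' + b * c', a * b' + b * d'; c * a' + d * c', c * b' + d * d'] := by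
  rw [Matrix.SpecialLinearGroup.coe_mul, hg, hh, Matrix.mul_fin_two]

omit [Finite F] in
theorem coe_one_eq : ((1 : SL(2, F)) : Matrix (Fin 2) (Fin 2) F) = !![1, 0; 0, 1] := by
  rw [Matrix.SpecialLinearGroup.coe_one, Matrix.one_fin_two]

omit [Finite F] in
theorem exists_orderOf_nine [CharP F 2] {τ : F} (hτ : τ ^ 3 = τ + 1) :
    ∃ g : PSL(2, F), orderOf g = 9 := by
  have h2 : (2 : F) = 0 := CharTwo.two_eq_zero
  obtain ⟨u, hu⟩ := exists_coe_eq (a := 0) (b := 1) (c := 1) (d := τ)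
    (by linear_combination -h2)
  obtain ⟨v, hv⟩ := exists_coe_eq (a := τ) (b := 1 + τ ^ 2) (c := 1 + τ ^ 2) (d := 1 + τ)
    (by linear_combination (-τ) * hτ - (1 + τ ^ 2) * h2)
  obtain ⟨w, hw⟩ := exists_coe_eq (a := τ + 1) (b := 1 + τ ^ 2) (c := 1 + τ ^ 2) (d := τ)
    (by linear_combination (-τ) * hτ - (1 + τ ^ 2) * h2)
  obtain ⟨h, hh⟩ := exists_coe_eq (F := F) (a := 1) (b := 1) (c := 0) (d := 1) (by ring)
  have huv : u ^ 3 = v := by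
    rw [pow_three]
    refine eq_of_coe_eq (coe_mul_eq hu (coe_mul_eq hu hu)) hv (by ring) (by ring) (by ring) ?_
    linear_combination hτ + τ * h2
  have hvw : v * v = w := by
    refine eq_of_coe_eq (coe_mul_eq hv hv) hw ?_ ?_ ?_ ?_
    · linear_combination τ * hτ + 2 * τ ^ 2 * h2
    · linear_combination τ * (1 + τ ^ 2) * h2
    · linear_combination τ * (1 + τ ^ 2) * h2
    · linear_combination τ * hτ + (2 * τ ^ 2 + τ + 1) * h2
  have hv3 : v ^ 3 = 1 := by
    rw [pow_three', hvw]
    refine eq_of_coe_eq (coe_mul_eq hw hv) coe_one_eq ?_ ?_ ?_ ?_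
    · linear_combination τ * hτ + (2 * τ ^ 2 + τ) * h2
    · linear_combination (1 + τ ^ 2) * (1 + τ) * h2
    · linear_combination (1 + τ ^ 2) * τ * h2
    · linear_combination τ * hτ + (2 * τ ^ 2 + τ) * h2
  refine ⟨u, orderOf_eq_prime_pow (p := 3) (n := 1) ?_ ?_⟩
  · refine mk_pow_ne_one_of_not_commute _ h ?_
    rw [pow_one, huv]
    intro e
    have e₀ := congrArg (fun g : SL(2, F) => (g : Matrix (Fin 2) (Fin 2) F) 0 0) e
    simp only [coe_mul_eq hv hh, coe_mul_eq hh hv, Matrix.of_apply, Matrix.cons_val_zero] at e₀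
    exact one_ne_zero (α := F) (by linear_combination -hτ - τ * e₀ - τ * h2)
  · refine mk_pow_eq_one_of_pow_eq_one ?_
    rw [show 3 ^ (1 + 1) = 3 * 3 from rfl, pow_mul, huv, hv3]

theorem exists_inverted_orderOf_seven [CharP F 2] (hF : Nat.card F = 8) {τ : F}
    (hτ : τ ^ 3 = τ + 1) : ∃ t i : PSL(2, F), orderOf t = 7 ∧ i * t * i⁻¹ = t⁻¹ := by
  have : Fact (Nat.Prime 7) := ⟨by norm_num⟩
  have h2 : (2 : F) = 0 := CharTwo.two_eq_zero
  have hσ : τ * (τ ^ 2 + 1) = 1 := by linear_combination hτ + τ * h2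
  have hpow : ∀ a : F, a ≠ 0 → a ^ 7 = 1 := by
    have := Fintype.ofFinite F
    intro a ha
    have := FiniteField.pow_card_sub_one_eq_one a ha
    rwa [← Nat.card_eq_fintype_card, hF] at this
  obtain ⟨t, ht⟩ := exists_coe_eq (a := τ) (b := 0) (c := 0) (d := τ ^ 2 + 1)
    (by linear_combination hσ)
  obtain ⟨i, hi⟩ := exists_coe_eq (F := F) (a := 0) (b := 1) (c := 1) (d := 0)
    (by linear_combination -h2)
  have hii : i * i = 1 :=
    eq_of_coe_eq (coe_mul_eq hi hi) coe_one_eq (by ring) (by ring) (by ring) (by ring)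
  have hit : i * t * i⁻¹ = t⁻¹ := by
    apply eq_inv_of_mul_eq_one_left
    rw [inv_eq_of_mul_eq_one_right hii]
    exact eq_of_coe_eq (coe_mul_eq (coe_mul_eq (coe_mul_eq hi ht) hi) ht) coe_one_eq
      (by linear_combination hσ) (by ring) (by ring) (by linear_combination hσ)
  refine ⟨t, i, orderOf_eq_prime (mk_pow_eq_one_of_pow_eq_one (Subtype.ext ?_)) ?_,
    congrArg (QuotientGroup.mk (s := Subgroup.center SL(2, F))) hit⟩
  · have htd : (t : Matrix (Fin 2) (Fin 2) F) = Matrix.diagonal ![τ, τ ^ 2 + 1] := by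
      rw [ht]
      ext i j
      fin_cases i <;> fin_cases j <;> simp
    rw [Matrix.SpecialLinearGroup.coe_pow, htd, Matrix.diagonal_pow,
      Matrix.SpecialLinearGroup.coe_one, ← Matrix.diagonal_one]
    congr 1
    ext j
    fin_cases j
    · exact hpow _ (left_ne_zero_of_mul_eq_one hσ)
    · exact hpow _ (right_ne_zero_of_mul_eq_one hσ)
  · rw [← pow_one (t : PSL(2, F))]
    refine mk_pow_ne_one_of_not_commute 1 i ?_
    rw [pow_one]
    intro e
    have e₀ := congrArg (fun g : SL(2, F) => (g : Matrix (Fin 2) (Fin 2) F) 0 1) e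
    simp only [coe_mul_eq ht hi, coe_mul_eq hi ht, Matrix.of_apply, Matrix.cons_val_zero,
      Matrix.cons_val_one] at e₀
    have h0 : τ = 0 := by linear_combination -hτ - (τ + 1) * e₀ - h2
    rw [h0, zero_mul] at hσ
    exact zero_ne_one hσ

theorem seven_le_omegaAut [CharP F 2] (hF : Nat.card F = 8) {G : Type*} [Group G] [Finite G]
    {φ : PSL(2, F) →* G} (hφ : Function.Injective φ) [φ.range.Characteristic]
    (hN : φ.range ≠ ⊤) : 7 ≤ omegaAut G := by
  have hcard := natCard hF
  obtain ⟨τ, hτ⟩ := exists_pow_three_eq_add_one hF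
  obtain ⟨t, i, hto, hit⟩ := exists_inverted_orderOf_seven hF hτ
  refine seven_le_omegaAut_of_inverted hφ hN
    (hcard ▸ factorization_eq_of_eq_pow_mul (c := 63) (by norm_num) rfl (by norm_num))
    (Or.inr (hcard ▸ factorization_eq_of_eq_pow_mul (c := 56) (by norm_num) rfl (by norm_num)))
    (Or.inr rfl)
    (hcard ▸ factorization_eq_of_eq_pow_mul (c := 72) (by norm_num) rfl (by norm_num))
    hto hit {1, 2, 3, 7, 9} rfl ?_
  intro k hk
  simp only [Finset.mem_insert, Finset.mem_singleton] at hk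
  rcases hk with rfl | rfl | rfl | rfl | rfl
  · exact ⟨1, orderOf_one⟩
  · exact exists_prime_orderOf_dvd_card' 2 (by rw [hcard]; norm_num)
  · exact exists_prime_orderOf_dvd_card' 3 (by rw [hcard]; norm_num)
  · exact ⟨t, hto⟩
  · exact exists_orderOf_nine hτ

end PSLTwoEight

theorem seven_le_omegaAut_of_equiv {G A : Type*} [Group G] [Group A] {N : Subgroup G}
    (hchar : N.Characteristic) (hproper : N ≠ ⊤) (e : N ≃* A)
    (H : ∀ φ : A →* G, Function.Injective φ → φ.range.Characteristic → φ.range ≠ ⊤ →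
      7 ≤ omegaAut G) : 7 ≤ omegaAut G := by
  have hr : (N.subtype.comp e.symm.toMonoidHom).range = N := by
    rw [MonoidHom.range_comp, MonoidHom.range_eq_top.2 e.symm.surjective,
      ← MonoidHom.range_eq_map, Subgroup.range_subtype]
  exact H _ (N.subtype_injective.comp e.symm.injective) (hr.symm ▸ hchar) (hr.symm ▸ hproper)

/-- If a finite group `G` has a proper characteristic subgroup isomorphic to
`A₅`, `A₆`, `PSL(2,7)` or `PSL(2,8)`, then `ω(G) ≥ 7`. -/
theorem stmt_8 (G : Type*) [Group G] [Finite G]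
    (N : Subgroup G) (hchar : N.Characteristic) (hproper : N ≠ ⊤)
    (hiso : Nonempty (N ≃* alternatingGroup (Fin 5)) ∨
            Nonempty (N ≃* alternatingGroup (Fin 6)) ∨
            Nonempty (N ≃* PSL(2, ZMod 7)) ∨
            Nonempty (N ≃* PSL(2, GaloisField 2 3))) :
    7 ≤ omegaAut G := by
  rcases hiso with ⟨⟨e⟩⟩ | ⟨⟨e⟩⟩ | ⟨⟨e⟩⟩ | ⟨⟨e⟩⟩
  · exact seven_le_omegaAut_of_equiv hchar hproper e fun φ hφ _ hN =>
      AlternatingFive.seven_le_omegaAut hφ hN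
  · exact seven_le_omegaAut_of_equiv hchar hproper e fun φ hφ _ hN =>
      AlternatingSix.seven_le_omegaAut hφ hN
  · exact seven_le_omegaAut_of_equiv hchar hproper e fun φ hφ _ hN =>
      PSLTwoSeven.seven_le_omegaAut hφ hN
  · exact seven_le_omegaAut_of_equiv hchar hproper e fun φ hφ _ hN =>
      PSLTwoEight.seven_le_omegaAut (by rw [GaloisField.card 2 3 (by norm_num)]; norm_num) hφ hN
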